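/- arXiv:2601.11800 — 2 statements merged into one kernel-verified Lean document; each statement's English description precedes it below -/
import Mathlib

section
/- Let R = (R₁, R₂) : ℝ² → ℝ² be twice continuously differentiable and satisfy the Cauchy–Riemann equations, and let f = (f₁, f₂) : ℝ² → ℝ² be continuously differentiable. Then at every point x ∈ ℝ²: div( (DR(x))ᵀ · f(R(x)) ) = (1/2)·‖DR(x)‖²_F · (div f)(R(x)), where DR is the Jacobian matrix of R, (DR)ᵀ its transpose, div f = ∂₁f₁ + ∂₂f₂, and the left-hand side is the divergence of the vector field x ↦ (DR(x))ᵀ f(R(x)). -/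
/-- The partial derivative in the first variable of a function on `ℝ²`. -/
noncomputable def pd1 {E : Type*} [NormedAddCommGroup E] [NormedSpace ℝ E]
    (g : ℝ × ℝ → E) (x : ℝ × ℝ) : E :=
  fderiv ℝ g x (1, 0)

/-- The partial derivative in the second variable of a function on `ℝ²`. -/
noncomputable def pd2 {E : Type*} [NormedAddCommGroup E] [NormedSpace ℝ E]
    (g : ℝ × ℝ → E) (x : ℝ × ℝ) : E :=
  fderiv ℝ g x (0, 1)

/-- The chain rule for a composition of maps of `ℝ²`, in coordinates. -/
theorem fderiv_comp_apply_prod {g : ℝ × ℝ → ℝ} {R : ℝ × ℝ → ℝ × ℝ} {x : ℝ × ℝ}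
    (hg : DifferentiableAt ℝ g (R x)) (hR : DifferentiableAt ℝ R x) (w : ℝ × ℝ) :
    fderiv ℝ (fun y => g (R y)) x w
      = fderiv ℝ (fun y => (R y).1) x w * pd1 g (R x)
        + fderiv ℝ (fun y => (R y).2) x w * pd2 g (R x) := by
  have h : ∀ a : ℝ × ℝ, fderiv ℝ g (R x) a = a.1 * pd1 g (R x) + a.2 * pd2 g (R x) := by
    intro a
    have ha : a = a.1 • ((1, 0) : ℝ × ℝ) + a.2 • ((0, 1) : ℝ × ℝ) := by ext <;> simp
    conv_lhs => rw [ha, map_add, map_smul, map_smul]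
    rfl
  have h₁ : fderiv ℝ (fun y => g (R y)) x = (fderiv ℝ g (R x)).comp (fderiv ℝ R x) :=
    fderiv_comp x hg hR
  rw [h₁, fderiv.fst hR, fderiv.snd hR, ContinuousLinearMap.comp_apply, h]
  rfl

/-- The Leibniz rule for a sum of two products, evaluated at a direction. -/
theorem fderiv_mul_add_mul_apply {p q r s : ℝ × ℝ → ℝ} {x : ℝ × ℝ}
    (hp : DifferentiableAt ℝ p x) (hq : DifferentiableAt ℝ q x)
    (hr : DifferentiableAt ℝ r x) (hs : DifferentiableAt ℝ s x) (w : ℝ × ℝ) :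
    fderiv ℝ (fun y => p y * q y + r y * s y) x w
      = p x * fderiv ℝ q x w + q x * fderiv ℝ p x w
        + (r x * fderiv ℝ s x w + s x * fderiv ℝ r x w) := by
  have h := ((hp.hasFDerivAt.mul hq.hasFDerivAt).add (hr.hasFDerivAt.mul hs.hasFDerivAt)).fderiv
  change fderiv ℝ (fun y => p y * q y + r y * s y) x = _ at h
  rw [h]
  simp

theorem ContDiff.differentiable_fderiv_apply_const {g : ℝ × ℝ → ℝ} (hg : ContDiff ℝ 2 g)
    (w : ℝ × ℝ) : Differentiable ℝ (fun y => fderiv ℝ g y w) :=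
  ((hg.fderiv_right (m := 1) (by norm_num)).differentiable one_ne_zero).clm_apply
    (differentiable_const w)

/-- The mixed partial derivatives of a `C²` function on `ℝ²` agree. -/
theorem pd1_pd2_comm {g : ℝ × ℝ → ℝ} (hg : ContDiff ℝ 2 g) (x : ℝ × ℝ) :
    pd1 (fun y => pd2 g y) x = pd2 (fun y => pd1 g y) x := by
  have hd : DifferentiableAt ℝ (fderiv ℝ g) x :=
    (hg.fderiv_right (m := 1) (by norm_num)).differentiable one_ne_zero x
  have h : ∀ v w : ℝ × ℝ,
      fderiv ℝ (fun y => fderiv ℝ g y w) x v = fderiv ℝ (fderiv ℝ g) x v w := by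
    intro v w
    rw [fderiv_clm_apply hd (differentiableAt_const w)]
    simp
  have hs : IsSymmSndFDerivAt ℝ g x := hg.contDiffAt.isSymmSndFDerivAt (by simp)
  unfold pd1 pd2
  rw [h, h]
  exact hs _ _

theorem pd1_neg (g : ℝ × ℝ → ℝ) (x : ℝ × ℝ) : pd1 (fun y => -g y) x = -pd1 g x := by
  simp [pd1, fderiv_fun_neg]

theorem pd2_neg (g : ℝ × ℝ → ℝ) (x : ℝ × ℝ) : pd2 (fun y => -g y) x = -pd2 g x := by
  simp [pd2, fderiv_fun_neg]

/-- Let `R : ℝ² → ℝ²` be `C²` and satisfy the Cauchy–Riemann equations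
`∂₁R₁ = ∂₂R₂`, `∂₂R₁ = -∂₁R₂`, and let `f : ℝ² → ℝ²` be `C¹`.  Then at every point `x`,
`div((DR(x))ᵀ f(R(x))) = (1/2)‖DR(x)‖²_F (div f)(R(x))`, where `‖DR‖²_F` is the sum of the
squares of the four partial derivatives of `R`. -/
theorem stmt4 (R f : ℝ × ℝ → ℝ × ℝ)
    (hR : ContDiff ℝ 2 R) (hf : ContDiff ℝ 1 f)
    (hCR : ∀ x : ℝ × ℝ,
      pd1 (fun y => (R y).1) x = pd2 (fun y => (R y).2) x ∧
      pd2 (fun y => (R y).1) x = -pd1 (fun y => (R y).2) x) :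
    ∀ x : ℝ × ℝ,
      pd1 (fun y => (f (R y)).1 * pd1 (fun z => (R z).1) y
            + (f (R y)).2 * pd1 (fun z => (R z).2) y) x
        + pd2 (fun y => (f (R y)).1 * pd2 (fun z => (R z).1) y
            + (f (R y)).2 * pd2 (fun z => (R z).2) y) x
      = (1 / 2) * ((pd1 (fun y => (R y).1) x) ^ 2 + (pd2 (fun y => (R y).1) x) ^ 2
            + (pd1 (fun y => (R y).2) x) ^ 2 + (pd2 (fun y => (R y).2) x) ^ 2)
          * (pd1 (fun y => (f y).1) (R x) + pd2 (fun y => (f y).2) (R x)) := by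
  intro x
  have hu : ContDiff ℝ 2 (fun y => (R y).1) := hR.fst
  have hv : ContDiff ℝ 2 (fun y => (R y).2) := hR.snd
  have hRd : DifferentiableAt ℝ R x := hR.differentiable two_ne_zero x
  have hfd : Differentiable ℝ f := hf.differentiable one_ne_zero
  have hf₁ : DifferentiableAt ℝ (fun y => (f y).1) (R x) := (hfd (R x)).fst
  have hf₂ : DifferentiableAt ℝ (fun y => (f y).2) (R x) := (hfd (R x)).snd
  have hc₁ : DifferentiableAt ℝ (fun y => (f (R y)).1) x := hf₁.comp x hRd
  have hc₂ : DifferentiableAt ℝ (fun y => (f (R y)).2) x := hf₂.comp x hRd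
  have expand : ∀ w : ℝ × ℝ, fderiv ℝ (fun y => (f (R y)).1 * fderiv ℝ (fun z => (R z).1) y w
      + (f (R y)).2 * fderiv ℝ (fun z => (R z).2) y w) x w = _ := fun w =>
    fderiv_mul_add_mul_apply hc₁ (hu.differentiable_fderiv_apply_const w x)
      hc₂ (hv.differentiable_fderiv_apply_const w x) w
  have chain₁ := fderiv_comp_apply_prod hf₁ hRd
  have chain₂ := fderiv_comp_apply_prod hf₂ hRd
  have e₁ := expand (1, 0)
  have e₂ := expand (0, 1)
  rw [chain₁, chain₂] at e₁ e₂
  simp only [← pd1.eq_1, ← pd2.eq_1] at e₁ e₂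
  have harm₁ : pd1 (fun y => pd1 (fun z => (R z).1) y) x
      = -pd2 (fun y => pd2 (fun z => (R z).1) y) x := by
    simp only [fun y => (hCR y).1, fun y => (hCR y).2, pd2_neg, neg_neg]
    exact pd1_pd2_comm hv x
  have harm₂ : pd2 (fun y => pd2 (fun z => (R z).2) y) x
      = -pd1 (fun y => pd1 (fun z => (R z).2) y) x := by
    have h : ∀ y, pd1 (fun z => (R z).2) y = -pd2 (fun z => (R z).1) y := fun y => by
      rw [(hCR y).2, neg_neg]
    simp only [fun y => (hCR y).1.symm, h, pd1_neg, neg_neg]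
    exact (pd1_pd2_comm hu x).symm
  rw [e₁, e₂, harm₁, harm₂, (hCR x).1, (hCR x).2]
  ring
end

section
/- Let h > 0. Let R = (R₁, R₂) : ℝ² → ℝ² be twice continuously differentiable, satisfy the Cauchy–Riemann equations, and satisfy the periodicity R(w + 1, z) = R(w, z) + (1, 0) for all (w, z) ∈ ℝ². Let f : ℝ² → ℝ² be continuously differentiable with f(x + (1,0)) = f(x) for all x ∈ ℝ². Then ∫₀¹ ∫₀ʰ (1/2)·‖DR(w,z)‖²_F · (div f)(R(w,z)) dz dw = ∫₀¹ f(R(w,h)) · (∂₁R(w,h))^⊥ dw − ∫₀¹ f(R(w,0)) · (∂₁R(w,0))^⊥ dw, where · denotes the Euclidean dot product in ℝ². -/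
/-- Piola identity in the plane: the divergence of the cofactor transform of `f ∘ R` is
`det DR` times the divergence of `f` evaluated at `R`. -/
theorem fderiv_piola {R f : ℝ × ℝ → ℝ × ℝ} (hR : ContDiff ℝ 2 R) (hf : ContDiff ℝ 1 f)
    (x : ℝ × ℝ) :
    fderiv ℝ (fun y => (f (R y)).1 * (fderiv ℝ R y (0, 1)).2
        - (f (R y)).2 * (fderiv ℝ R y (0, 1)).1) x (1, 0)
      + fderiv ℝ (fun y => (f (R y)).1 * (-(fderiv ℝ R y (1, 0)).2)
        + (f (R y)).2 * (fderiv ℝ R y (1, 0)).1) x (0, 1)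
      = ((fderiv ℝ R x (1, 0)).1 * (fderiv ℝ R x (0, 1)).2
          - (fderiv ℝ R x (0, 1)).1 * (fderiv ℝ R x (1, 0)).2)
        * ((fderiv ℝ f (R x) (1, 0)).1 + (fderiv ℝ f (R x) (0, 1)).2) := by
  have hRd : HasFDerivAt R (fderiv ℝ R x) x :=
    (hR.differentiable (by norm_num) x).hasFDerivAt
  have hfR : HasFDerivAt (fun y => f (R y)) ((fderiv ℝ f (R x)).comp (fderiv ℝ R x)) x :=
    ((hf.differentiable (by norm_num)) (R x)).hasFDerivAt.comp x hRd
  have hG : HasFDerivAt (fderiv ℝ R) (fderiv ℝ (fderiv ℝ R) x) x :=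
    ((hR.fderiv_right (m := 1) (by norm_num)).differentiable (by norm_num) x).hasFDerivAt
  have hGv (v : ℝ × ℝ) := hG.clm_apply (hasFDerivAt_const v x)
  have hsymm : fderiv ℝ (fderiv ℝ R) x (0, 1) (1, 0) = fderiv ℝ (fderiv ℝ R) x (1, 0) (0, 1) :=
    (hR.contDiffAt.isSymmSndFDerivAt (by simp)).eq _ _
  have hP := ((hfR.fst.mul (hGv (0, 1)).snd).sub (hfR.snd.mul (hGv (0, 1)).fst)).fderiv
  have hQ := ((hfR.fst.mul (hGv (1, 0)).snd.neg).add (hfR.snd.mul (hGv (1, 0)).fst)).fderiv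
  simp only [Pi.mul_def, Pi.add_def, Pi.sub_def, Pi.neg_def] at hP hQ
  rw [hP, hQ]
  have hlin (v : ℝ × ℝ) : fderiv ℝ f (R x) v
      = v.1 • fderiv ℝ f (R x) (1, 0) + v.2 • fderiv ℝ f (R x) (0, 1) := by
    rw [← map_smul, ← map_smul, ← map_add]
    simp
  simp [hsymm, hlin (fderiv ℝ R x _)]
  ring

/-- Let `h > 0`, let `R : ℝ² → ℝ²` be `C²`, satisfy the Cauchy–Riemann
equations, and be periodic in the sense `R(w + 1, z) = R(w, z) + (1, 0)`; let `f : ℝ² → ℝ²`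
be `C¹` and `1`-periodic in the first variable.  Then
`∫₀¹∫₀ʰ (1/2)‖DR‖²_F (div f)∘R dz dw
  = ∫₀¹ f(R(w,h))·(∂₁R(w,h))^⊥ dw - ∫₀¹ f(R(w,0))·(∂₁R(w,0))^⊥ dw`,
where `v^⊥ = (-v₂, v₁)` and `·` is the Euclidean dot product. -/
theorem stmt5 (h : ℝ) (hh : 0 < h) (R f : ℝ × ℝ → ℝ × ℝ)
    (hR : ContDiff ℝ 2 R) (hf : ContDiff ℝ 1 f)
    (hCR : ∀ x : ℝ × ℝ,
      pd1 (fun y => (R y).1) x = pd2 (fun y => (R y).2) x ∧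
      pd2 (fun y => (R y).1) x = -pd1 (fun y => (R y).2) x)
    (hRper : ∀ w z : ℝ, R (w + 1, z) = R (w, z) + (1, 0))
    (hfper : ∀ x : ℝ × ℝ, f (x + (1, 0)) = f x) :
    (∫ w in (0:ℝ)..1, ∫ z in (0:ℝ)..h,
        (1 / 2) * ((pd1 (fun y => (R y).1) (w, z)) ^ 2 + (pd2 (fun y => (R y).1) (w, z)) ^ 2
            + (pd1 (fun y => (R y).2) (w, z)) ^ 2 + (pd2 (fun y => (R y).2) (w, z)) ^ 2)
          * (pd1 (fun y => (f y).1) (R (w, z)) + pd2 (fun y => (f y).2) (R (w, z))))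
      = (∫ w in (0:ℝ)..1,
            ((f (R (w, h))).1 * (-(pd1 R (w, h)).2) + (f (R (w, h))).2 * (pd1 R (w, h)).1))
        - ∫ w in (0:ℝ)..1,
            ((f (R (w, 0))).1 * (-(pd1 R (w, 0)).2) + (f (R (w, 0))).2 * (pd1 R (w, 0)).1) := by
  have h1 : ∀ (g : ℝ × ℝ → ℝ × ℝ), Differentiable ℝ g → ∀ x v,
      fderiv ℝ (fun y => (g y).1) x v = (fderiv ℝ g x v).1 := fun g hg x v => by
    rw [(hg x).hasFDerivAt.fst.fderiv]; rfl
  have h2 : ∀ (g : ℝ × ℝ → ℝ × ℝ), Differentiable ℝ g → ∀ x v,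
      fderiv ℝ (fun y => (g y).2) x v = (fderiv ℝ g x v).2 := fun g hg x v => by
    rw [(hg x).hasFDerivAt.snd.fderiv]; rfl
  have hRd : Differentiable ℝ R := hR.differentiable (by norm_num)
  have hfd : Differentiable ℝ f := hf.differentiable (by norm_num)
  simp only [pd1, pd2, h1 R hRd, h2 R hRd, h1 f hfd, h2 f hfd] at hCR ⊢
  have hG : ContDiff ℝ 1 (fderiv ℝ R) := hR.fderiv_right (by norm_num)
  have hfR : ContDiff ℝ 1 (fun y => f (R y)) := hf.comp (hR.of_le (by norm_num))
  set P : ℝ × ℝ → ℝ := fun y => (f (R y)).1 * (fderiv ℝ R y (0, 1)).2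
    - (f (R y)).2 * (fderiv ℝ R y (0, 1)).1 with hPdef
  set Q : ℝ × ℝ → ℝ := fun y => (f (R y)).1 * (-(fderiv ℝ R y (1, 0)).2)
    + (f (R y)).2 * (fderiv ℝ R y (1, 0)).1 with hQdef
  have hGv (v : ℝ × ℝ) : ContDiff ℝ 1 (fun y => fderiv ℝ R y v) := hG.clm_apply contDiff_const
  have hP : ContDiff ℝ 1 P :=
    (hfR.fst.mul (hGv (0, 1)).snd).sub (hfR.snd.mul (hGv (0, 1)).fst)
  have hQ : ContDiff ℝ 1 Q :=
    (hfR.fst.mul (hGv (1, 0)).snd.neg).add (hfR.snd.mul (hGv (1, 0)).fst)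
  have hRshift : ∀ x, R (x + (1, 0)) = R x + (1, 0) := fun ⟨w, z⟩ => by simpa using hRper w z
  have hGper (x : ℝ × ℝ) : fderiv ℝ R (x + (1, 0)) = fderiv ℝ R x := by
    rw [← fderiv_comp_add_right, funext hRshift, fderiv_add_const]
  have hPper (z : ℝ) : P (1, z) = P (0, z) := by
    have hz : ((1, z) : ℝ × ℝ) = (0, z) + (1, 0) := by simp
    simp only [hPdef, hz, hRshift, hGper, hfper]
  have hcont : Continuous fun x => fderiv ℝ P x (1, 0) + fderiv ℝ Q x (0, 1) :=
    ((hP.continuous_fderiv (by norm_num)).clm_apply continuous_const).add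
      ((hQ.continuous_fderiv (by norm_num)).clm_apply continuous_const)
  have hdiv := MeasureTheory.integral2_divergence_prod_of_hasFDerivAt P Q
    (fderiv ℝ P) (fderiv ℝ Q) 0 0 1 h
    hP.continuous.continuousOn hQ.continuous.continuousOn
    (fun x _ => (hP.differentiable (by norm_num) x).hasFDerivAt)
    (fun x _ => (hQ.differentiable (by norm_num) x).hasFDerivAt)
    (hcont.continuousOn.integrableOn_compact (isCompact_uIcc.prod isCompact_uIcc))
  simp only [hPper, add_sub_cancel_right] at hdiv
  rw [← hdiv]
  congr! 4 with w z
  rw [fderiv_piola hR hf, (hCR _).2, (hCR _).1]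
  ring
end
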